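/- Let K be an algebraically closed field of characteristic zero, let R = K[x_1,…,x_n] and S = K[y_1,…,y_m], and let I ⊊ R and J ⊊ S be proper ideals. Then the ideal I + J (the sum of the extensions of I and J) in R ⊗ S = K[x_1,…,x_n,y_1,…,y_m] is unmixed if and only if both I is unmixed in R and J is unmixed in S. -/

import Mathlib

/-!
STATEMENT 1: For proper ideals `I ⊊ R = K[x_1,…,x_n]` and `J ⊊ S = K[y_1,…,y_m]`,
the ideal `I + J` (the sum of the extensions of `I` and `J` to
`R ⊗ S = K[x_1,…,x_n,y_1,…,y_m]`) is unmixed if and only if `I` and `J` are unmixed.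
-/

open MvPolynomial

/-- An ideal `I` of a commutative ring `R` is unmixed if `dim(R/I) = dim(R/P)` for every
associated prime `P` of `R/I`. -/
def Ideal.IsUnmixed {R : Type*} [CommRing R] (I : Ideal R) : Prop :=
  ∀ P ∈ associatedPrimes R (R ⧸ I), ringKrullDim (R ⧸ P) = ringKrullDim (R ⧸ I)

open TensorProduct

theorem ringKrullDim_eq_of_integral_inj {R S : Type*} [CommRing R] [CommRing S] (f : R →+* S)
    (hf : f.IsIntegral) (hinj : Function.Injective f) : ringKrullDim S = ringKrullDim R := by
  algebraize [f]
  have hinj' : Function.Injective (algebraMap R S) := hinj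
  apply le_antisymm
  · refine Order.krullDim_le_of_strictMono (PrimeSpectrum.comap (algebraMap R S)) ?_
    intro P Q hPQ
    have hle : P.asIdeal ≤ Q.asIdeal := hPQ.le
    obtain ⟨x, hxQ, hxP⟩ := SetLike.exists_of_lt (show P.asIdeal < Q.asIdeal from hPQ)
    exact Ideal.comap_lt_comap_of_integral_mem_sdiff (R := R) hle ⟨hxQ, hxP⟩
      (Algebra.IsIntegral.isIntegral x)
  · refine iSup_le fun l => ?_
    obtain ⟨Q, -, hQ, hQ2⟩ := Ideal.exists_ideal_over_prime_of_isIntegral (S := S) l.head.asIdeal ⊥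
      (by
        intro x hx
        have : x = 0 := hinj' (by simpa using hx)
        simp [this])
    have : Q.LiesOver l.head.asIdeal := ⟨hQ2.symm⟩
    obtain ⟨L, hL, -⟩ := Ideal.exists_ltSeries_of_hasGoingUp (S := S) l Q
    rw [← hL]
    exact Order.LTSeries.length_le_krullDim L

theorem ringKrullDim_tensor_fg {K D E : Type*} [Field K] [CommRing D] [CommRing E] [Algebra K D]
    [Algebra K E] [Nontrivial D] [Nontrivial E] [Algebra.FiniteType K D] [Algebra.FiniteType K E] :
    ∃ a b : ℕ, ringKrullDim D = a ∧ ringKrullDim E = b ∧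
      ringKrullDim (D ⊗[K] E) = ((a + b : ℕ) : WithBot ℕ∞) := by
  obtain ⟨a, f, hf, hfi⟩ := exists_integral_inj_algHom_of_fg K D
  obtain ⟨b, g, hg, hgi⟩ := exists_integral_inj_algHom_of_fg K E
  refine ⟨a, b, ?_, ?_, ?_⟩
  · rw [ringKrullDim_eq_of_integral_inj f.toRingHom hfi hf]; simp
  · rw [ringKrullDim_eq_of_integral_inj g.toRingHom hgi hg]; simp
  · rw [ringKrullDim_eq_of_integral_inj (Algebra.TensorProduct.map f g).toRingHom]
    · rw [ringKrullDim_eq_of_ringEquiv (tensorEquivSum K (Fin a) (Fin b) K).toRingEquiv]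
      simp
    · intro x
      induction x with
      | zero => exact RingHom.isIntegralElem_zero _
      | add x y hx hy => exact hx.add _ hy
      | tmul x y =>
        rw [show x ⊗ₜ[K] y = (x ⊗ₜ[K] 1) * (1 ⊗ₜ[K] y) by simp]
        refine RingHom.IsIntegralElem.mul _ ?_ ?_
        · obtain ⟨p, hp, hpx⟩ := hfi x
          refine ⟨p.map (Algebra.TensorProduct.includeLeft :
            MvPolynomial (Fin a) K →ₐ[K] _ ⊗[K] MvPolynomial (Fin b) K).toRingHom, hp.map _, ?_⟩
          have := congrArg (Algebra.TensorProduct.includeLeft : D →ₐ[K] D ⊗[K] E).toRingHom hpx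
          rw [Polynomial.hom_eval₂] at this
          rw [Polynomial.eval₂_map, ← map_zero
            (Algebra.TensorProduct.includeLeft : D →ₐ[K] D ⊗[K] E).toRingHom, ← this]
          congr 1
          ext <;> simp
        · obtain ⟨p, hp, hpx⟩ := hgi y
          refine ⟨p.map (Algebra.TensorProduct.includeRight :
            MvPolynomial (Fin b) K →ₐ[K] MvPolynomial (Fin a) K ⊗[K] _).toRingHom, hp.map _, ?_⟩
          have := congrArg (Algebra.TensorProduct.includeRight : E →ₐ[K] D ⊗[K] E).toRingHom hpx
          rw [Polynomial.hom_eval₂] at this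
          rw [Polynomial.eval₂_map, ← map_zero
            (Algebra.TensorProduct.includeRight : E →ₐ[K] D ⊗[K] E).toRingHom, ← this]
          congr 1
          ext
          · simp [← Algebra.TensorProduct.algebraMap_apply,
              ← Algebra.TensorProduct.algebraMap_apply']
          · simp
    · exact TensorProduct.map_injective_of_flat_flat _ _ hf hg

theorem isDomain_tensor_of_isAlgClosed {K A B : Type*} [Field K] [IsAlgClosed K] [CommRing A]
    [CommRing B] [Algebra K A] [Algebra K B] [IsDomain A] [IsDomain B] [Algebra.FiniteType K A] :
    IsDomain (A ⊗[K] B) := by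
  have hJ : IsJacobsonRing A := isJacobsonRing_of_finiteType (A := K)
  have key : ∀ x : A, (∀ φ : A →ₐ[K] K, φ x = 0) → x = 0 := by
    intro x hx
    have h0 : (⊥ : Ideal A).jacobson = ⊥ :=
      hJ.out (Ideal.isPrime_bot.isRadical)
    rw [← Ideal.mem_bot, ← h0, Ideal.jacobson, Ideal.mem_sInf]
    rintro M ⟨-, hM⟩
    let _ := Ideal.Quotient.field M
    have : Module.Finite K (A ⧸ M) := finite_of_finite_type_of_isJacobsonRing _ _
    have hb := IsAlgClosed.algebraMap_bijective_of_isIntegral (k := K) (K := A ⧸ M)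
    let e : K ≃ₐ[K] A ⧸ M := AlgEquiv.ofBijective (Algebra.ofId K _) hb
    have := hx ((e.symm : (A ⧸ M) →ₐ[K] K).comp (Ideal.Quotient.mkₐ K M))
    simpa [Ideal.Quotient.eq_zero_iff_mem] using this
  let b := Module.Basis.ofVectorSpace K B
  let bA := Algebra.TensorProduct.basis A b
  have hrepr : ∀ (φ : A →ₐ[K] K) (z : A ⊗[K] B) i,
      b.repr (Algebra.TensorProduct.lift (Algebra.ofId K B |>.comp φ) (AlgHom.id K B)
        (fun _ _ => Commute.all _ _) z) i = φ (bA.repr z i) := by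
    intro φ z i
    induction z with
    | zero => simp
    | add x y hx hy => simp [hx, hy]
    | tmul x y =>
      rw [Algebra.TensorProduct.lift_tmul]
      simp [bA, Algebra.ofId_apply, ← Algebra.smul_def]
  have : Nontrivial (A ⊗[K] B) := inferInstance
  have : NoZeroDivisors (A ⊗[K] B) := by
    refine ⟨fun {u v} huv => ?_⟩
    by_contra! h
    obtain ⟨hu, hv⟩ := h
    have hu' : ∃ i, bA.repr u i ≠ 0 := by
      by_contra! h
      exact hu (bA.repr.injective (by ext i; simp [h]))
    have hv' : ∃ i, bA.repr v i ≠ 0 := by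
      by_contra! h
      exact hv (bA.repr.injective (by ext i; simp [h]))
    obtain ⟨i, hi⟩ := hu'
    obtain ⟨j, hj⟩ := hv'
    refine mul_ne_zero hi hj (key _ fun φ => ?_)
    rw [map_mul, ← hrepr, ← hrepr]
    have := congrArg (Algebra.TensorProduct.lift (Algebra.ofId K B |>.comp φ) (AlgHom.id K B)
        (fun _ _ => Commute.all _ _)) huv
    rw [map_mul, map_zero] at this
    rcases mul_eq_zero.1 this with h | h <;> rw [h] <;> simp
  exact NoZeroDivisors.to_isDomain _

theorem ass_tensor_filtration {R T : Type*} [CommRing R] [CommRing T] [IsNoetherianRing R]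
    [Algebra R T] (W : Type*) [AddCommGroup W] [Module R W] [Module T W] [IsScalarTower R T W]
    [Module.Flat R W] (M : Type*) [AddCommGroup M] [Module R M] [hM : Module.Finite R M]
    (𝔓 : Ideal T) (h : 𝔓 ∈ associatedPrimes T (W ⊗[R] M)) :
    ∃ P : Ideal R, P.IsPrime ∧ 𝔓 ∈ associatedPrimes T (W ⊗[R] (R ⧸ P)) := by
  induction hM using IsNoetherianRing.induction_on_isQuotientEquivQuotientPrime R with
  | subsingleton N =>
    exfalso
    exact not_isAssociatedPrime_of_subsingleton h
  | quotient N p f =>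
    refine ⟨p.1, p.2, ?_⟩
    rwa [← LinearEquiv.AssociatedPrimes.eq
      (TensorProduct.AlgebraTensorModule.congr (LinearEquiv.refl T W) f)]
  | exact N₁ N₂ N₃ f g hf hg hfg h₁ h₃ =>
    have := associatedPrimes.subset_union_of_exact (R := T)
      (f := TensorProduct.AlgebraTensorModule.map (LinearMap.id : W →ₗ[T] W) f)
      (g := TensorProduct.AlgebraTensorModule.map (LinearMap.id : W →ₗ[T] W) g)
      (Module.Flat.lTensor_preserves_injective_linearMap (M := W) f hf)
      (lTensor_exact W hfg hg) h
    rcases this with h | h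
    · exact h₁ h
    · exact h₃ h

noncomputable def quotSupEquivTensor {R T : Type*} [CommRing R] [CommRing T]
    [Algebra R T] (𝔟 : Ideal T) (I : Ideal R) :
    (T ⧸ 𝔟 ⊔ I.map (algebraMap R T)) ≃ₗ[T] (T ⧸ 𝔟) ⊗[R] (R ⧸ I) :=
  (DoubleQuot.quotQuotEquivQuotSupₐ T 𝔟 (I.map (algebraMap R T))).symm.toLinearEquiv ≪≫ₗ
  (Ideal.quotientEquivAlgOfEq T (Ideal.map_map (algebraMap R T) (Ideal.Quotient.mk 𝔟))).toLinearEquiv ≪≫ₗ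
  (Algebra.TensorProduct.quotIdealMapEquivTensorQuot (T ⧸ 𝔟) I).toLinearEquiv.restrictScalars T

theorem ass_quot_filtration {R T : Type*} [CommRing R] [CommRing T] [IsNoetherianRing R]
    [Algebra R T] (𝔟 : Ideal T) [Module.Flat R (T ⧸ 𝔟)] (I : Ideal R)
    (𝔓 : Ideal T) (h : 𝔓 ∈ associatedPrimes T (T ⧸ 𝔟 ⊔ I.map (algebraMap R T))) :
    ∃ P : Ideal R, P.IsPrime ∧ 𝔓 ∈ associatedPrimes T (T ⧸ 𝔟 ⊔ P.map (algebraMap R T)) := by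
  rw [LinearEquiv.AssociatedPrimes.eq (quotSupEquivTensor 𝔟 I)] at h
  obtain ⟨P, hP, h⟩ := ass_tensor_filtration _ _ _ h
  refine ⟨P, hP, ?_⟩
  rwa [LinearEquiv.AssociatedPrimes.eq (quotSupEquivTensor 𝔟 P)]

theorem ass_quot_comap {R T : Type*} [CommRing R] [CommRing T] [IsNoetherianRing R]
    [IsNoetherianRing T]
    [Algebra R T] (𝔟 : Ideal T) [Module.Flat R (T ⧸ 𝔟)] (I : Ideal R)
    (𝔓 : Ideal T) (h : 𝔓 ∈ associatedPrimes T (T ⧸ 𝔟 ⊔ I.map (algebraMap R T))) :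
    ∃ P ∈ associatedPrimes R (R ⧸ I), 𝔓.comap (algebraMap R T) ≤ P := by
  rw [LinearEquiv.AssociatedPrimes.eq (quotSupEquivTensor 𝔟 I)] at h
  have hp := h.isPrime
  obtain ⟨-, x, hx⟩ := isAssociatedPrime_iff.1 h
  have hfin := associatedPrimes.finite R (R ⧸ I)
  have hsub : ((𝔓.comap (algebraMap R T) : Ideal R) : Set R) ⊆
      ⋃ p ∈ hfin.toFinset, ((p : Ideal R) : Set R) := by
    have := biUnion_associatedPrimes_eq_zero_divisors R (R ⧸ I)
    simp only [Set.Finite.mem_toFinset]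
    rw [this]
    intro r hr
    by_contra hcon
    simp only [Set.mem_ofPred_eq, not_exists, not_and] at hcon
    have hinj : Function.Injective (LinearMap.lsmul R (R ⧸ I) r) := by
      rw [injective_iff_map_eq_zero]
      intro a ha
      by_contra h0
      exact hcon a h0 ha
    have hinj2 := Module.Flat.lTensor_preserves_injective_linearMap (M := T ⧸ 𝔟) _ hinj
    have hx0 : x ≠ 0 := by
      rintro rfl
      exact hp.ne_top (by rw [hx]; simp)
    apply hx0
    apply hinj2
    rw [map_zero]
    have : ∀ y : (T ⧸ 𝔟) ⊗[R] (R ⧸ I),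
        (LinearMap.lTensor (T ⧸ 𝔟) (LinearMap.lsmul R (R ⧸ I) r)) y = algebraMap R T r • y := by
      intro y
      rw [algebraMap_smul]
      induction y with
      | zero => simp
      | add a b ha hb => rw [map_add, ha, hb, smul_add]
      | tmul a b => simp [TensorProduct.tmul_smul]
    rw [this]
    have hr' : algebraMap R T r ∈ 𝔓 := hr
    rw [hx] at hr'
    rwa [Submodule.mem_colon_singleton, Submodule.mem_bot] at hr'
  have := (Ideal.subset_union_prime (f := fun p : Ideal R => p) (s := hfin.toFinset) ⊥ ⊥
    (fun p hp _ _ => ((Set.Finite.mem_toFinset _).1 hp).isPrime)).1 hsub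
  simpa using this

theorem flat_quot_of_pushout (K R S T : Type*) [Field K] [CommRing R] [CommRing S] [CommRing T]
    [Algebra K R] [Algebra K S] [Algebra K T] [Algebra R T] [Algebra S T] [IsScalarTower K R T]
    [IsScalarTower K S T] [Algebra.IsPushout K R S T] (J : Ideal S) :
    Module.Flat R (T ⧸ J.map (algebraMap S T)) :=
  Module.Flat.of_linearEquiv
    (((Algebra.TensorProduct.quotIdealMapEquivTensorQuot T J).toLinearEquiv.restrictScalars R) ≪≫ₗ
      Algebra.IsPushout.cancelBaseChange K R S T (S ⧸ J))

section
variable (K R S T : Type*) [Field K] [CommRing R] [CommRing S] [CommRing T]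
    [Algebra K R] [Algebra K S] [Algebra K T] [Algebra R T] [Algebra S T] [IsScalarTower K R T]
    [IsScalarTower K S T] [Algebra.IsPushout K R S T] (I : Ideal R) (J : Ideal S)

/-- The quotient map `T → R/I ⊗ S/J`. -/
noncomputable def pushoutQuot : T →ₐ[K] (R ⧸ I) ⊗[K] (S ⧸ J) :=
  (Algebra.TensorProduct.map (Ideal.Quotient.mkₐ K I) (Ideal.Quotient.mkₐ K J)).comp
    ((Algebra.IsPushout.equiv K R S T).symm.restrictScalars K : T →ₐ[K] R ⊗[K] S)

theorem pushoutQuot_surjective : Function.Surjective (pushoutQuot K R S T I J) := by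
  have h1 : Function.Surjective (Algebra.TensorProduct.map (Ideal.Quotient.mkₐ K I)
      (Ideal.Quotient.mkₐ K J)) :=
    TensorProduct.map_surjective (g := (Ideal.Quotient.mkₐ K I).toLinearMap)
      (g' := (Ideal.Quotient.mkₐ K J).toLinearMap) (Ideal.Quotient.mkₐ_surjective K I)
      (Ideal.Quotient.mkₐ_surjective K J)
  have h2 := (Algebra.IsPushout.equiv K R S T).symm.surjective
  exact h1.comp h2

theorem ker_pushoutQuot : RingHom.ker (pushoutQuot K R S T I J) =
    I.map (algebraMap R T) ⊔ J.map (algebraMap S T) := by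
  have h := Algebra.TensorProduct.map_ker (f := Ideal.Quotient.mkₐ K I)
    (g := Ideal.Quotient.mkₐ K J) (Ideal.Quotient.mkₐ_surjective K I)
    (Ideal.Quotient.mkₐ_surjective K J)
  have hkI : RingHom.ker (Ideal.Quotient.mkₐ K I) = I := by
    ext x; simp [RingHom.mem_ker, Ideal.Quotient.eq_zero_iff_mem]
  have hkJ : RingHom.ker (Ideal.Quotient.mkₐ K J) = J := by
    ext x; simp [RingHom.mem_ker, Ideal.Quotient.eq_zero_iff_mem]
  rw [hkI, hkJ] at h
  let e : R ⊗[K] S ≃+* T := (Algebra.IsPushout.equiv K R S T).toRingEquiv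
  have h1 : RingHom.ker (pushoutQuot K R S T I J) =
      (RingHom.ker (Algebra.TensorProduct.map (Ideal.Quotient.mkₐ K I)
        (Ideal.Quotient.mkₐ K J))).comap (e.symm : T →+* R ⊗[K] S) := by
    ext x; rfl
  rw [h1, h]
  refine (Ideal.comap_symm e).trans ?_
  rw [Ideal.map_sup]
  have h2 : Ideal.map e (Ideal.map (Algebra.TensorProduct.includeLeft : R →ₐ[K] R ⊗[K] S) I)
      = I.map (algebraMap R T) := by
    refine (Ideal.map_map (Algebra.TensorProduct.includeLeft : R →ₐ[K] R ⊗[K] S).toRingHom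
      (e : R ⊗[K] S →+* T)).trans ?_
    congr 1
    ext x
    simp [e, Algebra.IsPushout.equiv_tmul]
  have h3 : Ideal.map e (Ideal.map (Algebra.TensorProduct.includeRight : S →ₐ[K] R ⊗[K] S) J)
      = J.map (algebraMap S T) := by
    refine (Ideal.map_map (Algebra.TensorProduct.includeRight : S →ₐ[K] R ⊗[K] S).toRingHom
      (e : R ⊗[K] S →+* T)).trans ?_
    congr 1
    ext x
    simp [e, Algebra.IsPushout.equiv_tmul]
  exact congrArg₂ _ h2 h3

noncomputable def pushoutQuotEquiv :
    (T ⧸ I.map (algebraMap R T) ⊔ J.map (algebraMap S T)) ≃ₐ[K] (R ⧸ I) ⊗[K] (S ⧸ J) :=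
  (Ideal.quotientEquivAlgOfEq K (ker_pushoutQuot K R S T I J).symm).trans
    (Ideal.quotientKerAlgEquivOfSurjective (pushoutQuot_surjective K R S T I J))

theorem isPrime_pushout_sup [IsAlgClosed K] [Algebra.FiniteType K R] [I.IsPrime] [J.IsPrime] :
    (I.map (algebraMap R T) ⊔ J.map (algebraMap S T)).IsPrime := by
  rw [← Ideal.Quotient.isDomain_iff_prime]
  have : IsDomain ((R ⧸ I) ⊗[K] (S ⧸ J)) := isDomain_tensor_of_isAlgClosed
  exact (pushoutQuotEquiv K R S T I J).toRingEquiv.isDomain_iff.2 this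

theorem dim_pushout_sup [Algebra.FiniteType K R] [Algebra.FiniteType K S] (hI : I ≠ ⊤)
    (hJ : J ≠ ⊤) : ∃ a b : ℕ, ringKrullDim (R ⧸ I) = a ∧ ringKrullDim (S ⧸ J) = b ∧
      ringKrullDim (T ⧸ I.map (algebraMap R T) ⊔ J.map (algebraMap S T)) =
        ((a + b : ℕ) : WithBot ℕ∞) := by
  have := Ideal.Quotient.nontrivial_iff.2 hI
  have := Ideal.Quotient.nontrivial_iff.2 hJ
  rw [ringKrullDim_eq_of_ringEquiv (pushoutQuotEquiv K R S T I J).toRingEquiv]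
  exact ringKrullDim_tensor_fg

theorem ass_pushout_sup [IsAlgClosed K] [Algebra.FiniteType K R] [IsNoetherianRing R]
    [IsNoetherianRing S]
    (P : Ideal R) (Q : Ideal S) (hP : P ∈ associatedPrimes R (R ⧸ I))
    (hQ : Q ∈ associatedPrimes S (S ⧸ J)) :
    P.map (algebraMap R T) ⊔ Q.map (algebraMap S T) ∈
      associatedPrimes T (T ⧸ I.map (algebraMap R T) ⊔ J.map (algebraMap S T)) := by
  have hPp : P.IsPrime := hP.isPrime
  have hQp : Q.IsPrime := hQ.isPrime
  have hprime := isPrime_pushout_sup K R S T P Q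
  obtain ⟨f, hf⟩ := ((isAssociatedPrime_iff_exists_injective_linearMap _ _).1 hP).2
  obtain ⟨g, hg⟩ := ((isAssociatedPrime_iff_exists_injective_linearMap _ _).1 hQ).2
  let F : (R ⧸ P) ⊗[K] (S ⧸ Q) →ₗ[K] (R ⧸ I) ⊗[K] (S ⧸ J) :=
    TensorProduct.map (f.restrictScalars K) (g.restrictScalars K)
  have hF : Function.Injective F := TensorProduct.map_injective_of_flat_flat _ _ hf hg
  let e := pushoutQuotEquiv K R S T I J
  let e' := pushoutQuotEquiv K R S T P Q
  have hlin : ∀ (t : T) z, F (pushoutQuot K R S T P Q t * z) = pushoutQuot K R S T I J t * F z := by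
    intro t z
    obtain ⟨u, rfl⟩ := (Algebra.IsPushout.equiv K R S T).surjective t
    induction z with
    | zero => simp
    | add x y hx hy => simp [mul_add, hx, hy]
    | tmul x y =>
      induction u with
      | zero => simp
      | add a b ha hb => simp only [map_add, add_mul, ha, hb]
      | tmul a b =>
        have hfa : f (Ideal.Quotient.mk P a * x) = Ideal.Quotient.mk I a * f x :=
          f.map_smul a x
        have hgb : g (Ideal.Quotient.mk Q b * y) = Ideal.Quotient.mk J b * g y :=
          g.map_smul b y
        simp [pushoutQuot, F, hfa, hgb]
  let G : (T ⧸ P.map (algebraMap R T) ⊔ Q.map (algebraMap S T)) →ₗ[T]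
      (T ⧸ I.map (algebraMap R T) ⊔ J.map (algebraMap S T)) :=
    { toFun := fun x => e.symm (F (e' x))
      map_add' := by simp
      map_smul' := by
        intro t x
        have h1 : e' (t • x) = pushoutQuot K R S T P Q t * e' x := by
          rw [Algebra.smul_def, map_mul]; rfl
        have h2 : e (algebraMap T _ t) = pushoutQuot K R S T I J t := rfl
        rw [h1, hlin, RingHom.id_apply, Algebra.smul_def, map_mul, ← h2, e.symm_apply_apply] }
  have hG : Function.Injective G := e.symm.injective.comp (hF.comp e'.injective)
  refine associatedPrimes.subset_of_injective hG ?_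
  refine ⟨hprime, 1, ?_⟩
  rw [eq_comm, ← hprime.radical]
  congr 1
  ext x
  rw [Submodule.mem_colon_singleton, Submodule.mem_bot, Algebra.smul_def, mul_one]
  simp [Ideal.Quotient.eq_zero_iff_mem, hprime.radical]

theorem ass_eq_pushout_sup [IsAlgClosed K] [Algebra.FiniteType K R] [IsNoetherianRing R]
    [IsNoetherianRing S] [IsNoetherianRing T] (𝔓 : Ideal T)
    (h : 𝔓 ∈ associatedPrimes T (T ⧸ I.map (algebraMap R T) ⊔ J.map (algebraMap S T))) :
    ∃ (P : Ideal R) (Q : Ideal S), P.IsPrime ∧ Q.IsPrime ∧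
      𝔓 = P.map (algebraMap R T) ⊔ Q.map (algebraMap S T) := by
  have : Algebra.IsPushout K S R T := Algebra.IsPushout.symm inferInstance
  rw [sup_comm] at h
  have := flat_quot_of_pushout K R S T J
  obtain ⟨P, hP, h⟩ := ass_quot_filtration _ _ _ h
  rw [sup_comm] at h
  have := flat_quot_of_pushout K S R T P
  obtain ⟨Q, hQ, h⟩ := ass_quot_filtration _ _ _ h
  have hprime := isPrime_pushout_sup K R S T P Q
  refine ⟨P, Q, hP, hQ, ?_⟩
  rw [associatedPrimes.eq_singleton_of_isPrimary hprime.isPrimary, hprime.radical] at h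
  exact h

theorem le_of_mem_ass {A : Type*} [CommRing A] {I P : Ideal A}
    (h : P ∈ associatedPrimes A (A ⧸ I)) : I ≤ P := by
  have := IsAssociatedPrime.annihilator_le h
  rwa [Submodule.annihilator_top, Ideal.annihilator_quotient] at this

theorem dim_quot_anti {R : Type*} [CommRing R] {I J : Ideal R} (h : I ≤ J) :
    ringKrullDim (R ⧸ J) ≤ ringKrullDim (R ⧸ I) :=
  ringKrullDim_le_of_surjective (Ideal.Quotient.factor h) (Ideal.Quotient.factor_surjective h)

theorem isUnmixed_pushout_iff [IsAlgClosed K] [Algebra.FiniteType K R] [Algebra.FiniteType K S]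
    [IsNoetherianRing R] [IsNoetherianRing S] [IsNoetherianRing T] (hI : I ≠ ⊤) (hJ : J ≠ ⊤) :
    (I.map (algebraMap R T) ⊔ J.map (algebraMap S T)).IsUnmixed ↔ I.IsUnmixed ∧ J.IsUnmixed := by
  have hpush : Algebra.IsPushout K S R T := Algebra.IsPushout.symm inferInstance
  obtain ⟨a, b, ha, hb, hab⟩ := dim_pushout_sup K R S T I J hI hJ
  have := Ideal.Quotient.nontrivial_iff.2 hI
  have := Ideal.Quotient.nontrivial_iff.2 hJ
  constructor
  · intro H
    have main : ∀ P ∈ associatedPrimes R (R ⧸ I), ∀ Q ∈ associatedPrimes S (S ⧸ J),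
        ringKrullDim (R ⧸ P) = ringKrullDim (R ⧸ I) ∧
        ringKrullDim (S ⧸ Q) = ringKrullDim (S ⧸ J) := by
      intro P hP Q hQ
      obtain ⟨c, d, hc, hd, hcd⟩ := dim_pushout_sup K R S T P Q hP.isPrime.ne_top hQ.isPrime.ne_top
      have h1 := H _ (ass_pushout_sup K R S T I J P Q hP hQ)
      have h2 := dim_quot_anti (le_of_mem_ass hP)
      have h3 := dim_quot_anti (le_of_mem_ass hQ)
      rw [hcd, hab] at h1
      rw [hc, ha] at h2 ⊢
      rw [hd, hb] at h3 ⊢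
      norm_cast at h1 h2 h3 ⊢
      omega
    obtain ⟨P₀, hP₀⟩ := associatedPrimes.nonempty R (R ⧸ I)
    obtain ⟨Q₀, hQ₀⟩ := associatedPrimes.nonempty S (S ⧸ J)
    exact ⟨fun P hP => (main P hP Q₀ hQ₀).1, fun Q hQ => (main P₀ hP₀ Q hQ).2⟩
  · rintro ⟨HI, HJ⟩ 𝔓 h𝔓
    obtain ⟨P, Q, hP, hQ, heq⟩ := ass_eq_pushout_sup K R S T I J 𝔓 h𝔓
    obtain ⟨c, d, hc, hd, hcd⟩ := dim_pushout_sup K R S T P Q hP.ne_top hQ.ne_top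
    have f1 := flat_quot_of_pushout K R S T J
    have f2 := flat_quot_of_pushout K S R T I
    obtain ⟨Q', hQ', hQQ'⟩ := ass_quot_comap _ _ _ h𝔓
    have h3 := dim_quot_anti (le_of_mem_ass h𝔓)
    rw [sup_comm] at h𝔓
    obtain ⟨P', hP', hPP'⟩ := ass_quot_comap _ _ _ h𝔓
    have hPle : P ≤ P' := le_trans (Ideal.map_le_iff_le_comap.1 (heq ▸ le_sup_left)) hPP'
    have hQle : Q ≤ Q' := le_trans (Ideal.map_le_iff_le_comap.1 (heq ▸ le_sup_right)) hQQ'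
    have h1 := dim_quot_anti hPle
    have h2 := dim_quot_anti hQle
    rw [HI P' hP', ha, hc] at h1
    rw [HJ Q' hQ', hb, hd] at h2
    rw [heq, hcd] at h3 ⊢
    rw [hab] at h3 ⊢
    norm_cast at h1 h2 h3 ⊢
    omega

end

theorem isUnmixed_equiv_iff {K R S T : Type*} [Field K] [CommRing R] [CommRing S] [CommRing T]
    [Algebra K R] [Algebra K S] [Algebra K T] [IsAlgClosed K]
    [Algebra.FiniteType K R] [Algebra.FiniteType K S]
    [IsNoetherianRing R] [IsNoetherianRing S] [IsNoetherianRing T]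
    (e : R ⊗[K] S ≃ₐ[K] T) (f : R →ₐ[K] T) (g : S →ₐ[K] T)
    (hl : ∀ x, e (x ⊗ₜ 1) = f x) (hr : ∀ x, e (1 ⊗ₜ x) = g x)
    (I : Ideal R) (J : Ideal S) (hI : I ≠ ⊤) (hJ : J ≠ ⊤) :
    (Ideal.map f I ⊔ Ideal.map g J).IsUnmixed ↔ I.IsUnmixed ∧ J.IsUnmixed := by
  let a1 : Algebra R T := f.toRingHom.toAlgebra
  let a2 : Algebra S T := g.toRingHom.toAlgebra
  have t1 : IsScalarTower K R T := IsScalarTower.of_algebraMap_eq fun x => (f.commutes x).symm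
  have t2 : IsScalarTower K S T := IsScalarTower.of_algebraMap_eq fun x => (g.commutes x).symm
  let e' : (R ⊗[K] S) ≃ₐ[R] T := AlgEquiv.ofRingEquiv (f := e.toRingEquiv) (fun x => hl x)
  let a3 : Algebra S (R ⊗[K] S) := Algebra.TensorProduct.rightAlgebra
  have hp : Algebra.IsPushout K R S T :=
    Algebra.IsPushout.of_equiv e' (RingHom.ext fun x => hr x)
  exact isUnmixed_pushout_iff K R S T I J hI hJ

theorem isUnmixed_sum_iff
    (K : Type*) [Field K] [IsAlgClosed K] [CharZero K] (n m : ℕ)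
    (I : Ideal (MvPolynomial (Fin n) K)) (J : Ideal (MvPolynomial (Fin m) K))
    (hI : I ≠ ⊤) (hJ : J ≠ ⊤) :
    (Ideal.map (rename (R := K) (Sum.inl : Fin n → Fin n ⊕ Fin m)) I ⊔
        Ideal.map (rename (R := K) (Sum.inr : Fin m → Fin n ⊕ Fin m)) J).IsUnmixed ↔
      I.IsUnmixed ∧ J.IsUnmixed := by
  refine isUnmixed_equiv_iff (tensorEquivSum K (Fin n) (Fin m) K) _ _ ?_ ?_ I J hI hJ
  · intro x
    have : (tensorEquivSum K (Fin n) (Fin m) K).toAlgHom.comp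
      Algebra.TensorProduct.includeLeft = rename (R := K) (Sum.inl : Fin n → Fin n ⊕ Fin m) := by
      ext i; simp
    exact DFunLike.congr_fun this x
  · intro x
    have : ((tensorEquivSum K (Fin n) (Fin m) K).toAlgHom.restrictScalars K).comp
      Algebra.TensorProduct.includeRight = rename (R := K) (Sum.inr : Fin m → Fin n ⊕ Fin m) := by
      ext i; simp
    exact DFunLike.congr_fun this x
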